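/- arXiv:2010.13473 — 3 statements merged into one kernel-verified Lean document; each statement's English description precedes it below -/
import Mathlib

section
/- There are uncountably many locally optimal geometric graphs on ℤ²: the set of geometric graphs G on ℤ² that are plane, have maximum degree at most 3, and satisfy d_G(p,q) ≤ (1+√2)·|p−q| for every pair p, q ∈ ℤ² with |p−q| ≤ √5, is uncountable (it has cardinality at least 2^ℵ₀). -/
open SimpleGraph ENNReal

/-- The point of the Euclidean plane (identified with `ℂ`) corresponding to a lattice point. -/
noncomputable def toC (p : ℤ × ℤ) : ℂ := ⟨(p.1 : ℝ), (p.2 : ℝ)⟩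

/-- The Euclidean length of a walk in a geometric graph on `ℤ²`:
the sum of the Euclidean lengths of its edges. -/
noncomputable def walkLen (G : SimpleGraph (ℤ × ℤ)) :
    ∀ {p q : ℤ × ℤ}, G.Walk p q → ℝ
  | _, _, .nil => 0
  | p, _, .cons (v := v) _ w => dist (toC p) (toC v) + walkLen G w

/-- The graph distance `d_G(p,q)`: infimum of Euclidean lengths of walks from `p` to `q`
(`∞` if there is no walk). -/
noncomputable def gdist (G : SimpleGraph (ℤ × ℤ)) (p q : ℤ × ℤ) : ℝ≥0∞ :=
  ⨅ w : G.Walk p q, ENNReal.ofReal (walkLen G w)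

/-- `G` has maximum degree at most `3`. -/
def MaxDegThree (G : SimpleGraph (ℤ × ℤ)) : Prop :=
  ∀ v : ℤ × ℤ, (G.neighborSet v).encard ≤ 3

/-- `G` is plane: two distinct edges, viewed as closed segments in the plane,
intersect at most in a common endpoint. -/
def IsPlane (G : SimpleGraph (ℤ × ℤ)) : Prop :=
  ∀ a b c d : ℤ × ℤ, G.Adj a b → G.Adj c d → s(a, b) ≠ s(c, d) →
    ∀ x : ℂ, x ∈ segment ℝ (toC a) (toC b) → x ∈ segment ℝ (toC c) (toC d) →
      x ∈ ({toC a, toC b} : Set ℂ) ∧ x ∈ ({toC c, toC d} : Set ℂ)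

/-- `G` is locally optimal. -/
def LocallyOptimal (G : SimpleGraph (ℤ × ℤ)) : Prop :=
  IsPlane G ∧ MaxDegThree G ∧
    ∀ p q : ℤ × ℤ, dist (toC p) (toC q) ≤ Real.sqrt 5 →
      gdist G p q ≤ ENNReal.ofReal ((1 + Real.sqrt 2) * dist (toC p) (toC q))

/-- The dilation of `G`. -/
noncomputable def dil (G : SimpleGraph (ℤ × ℤ)) : ℝ≥0∞ :=
  ⨆ (p : ℤ × ℤ) (q : ℤ × ℤ) (_ : p ≠ q),
    gdist G p q / ENNReal.ofReal (dist (toC p) (toC q))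

namespace ShearedStrips

/-- Whether the lattice point `p` with `p.1 + 4 * p.2 = s` is joined to `p + e`, where `e` is one of
`(1, 0)`, `(0, 1)`, `(1, -1)`. The strip `10 * k ≤ s < 10 * k + 10` has one of two patterns,
selected by `b k`. -/
def fwd (b : ℤ → Bool) (s : ℤ) (e : ℤ × ℤ) : Bool :=
  (e == (1, 0) && (s % 10 == 0 || s % 10 == 3 || s % 10 == 6 || s % 10 == 8 ||
    b (s / 10) && (s % 10 == 1 || s % 10 == 5))) ||
  (e == (0, 1) && (s % 10 == 4 || s % 10 == 6 || s % 10 == 7 || s % 10 == 9 ||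
    !b (s / 10) && (s % 10 == 1 || s % 10 == 2))) ||
  (e == (1, -1) && (s % 10 == 2 || s % 10 == 3 || s % 10 == 5 || s % 10 == 7 || s % 10 == 8))

/-- The linear form whose level sets index the strips. -/
def level (p : ℤ × ℤ) : ℤ := p.1 + 4 * p.2

/-- Whether a point of level `s` is joined to its translate by `e`, in either orientation. -/
def edge (b : ℤ → Bool) (s : ℤ) (e : ℤ × ℤ) : Bool :=
  fwd b s e || fwd b (s + level e) (-e)

/-- The graph with strip patterns `b`. -/
def stripGraph (b : ℤ → Bool) : SimpleGraph (ℤ × ℤ) where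
  Adj p q := edge b (level p) (q - p) = true
  symm := ⟨fun p q h => by
    have h1 : level p + level (q - p) = level q := by simp [level]; ring
    have h2 : level q + level (p - q) = level p := by simp [level]; ring
    simp only [edge, h1, h2, neg_sub, Bool.or_eq_true] at h ⊢
    exact h.symm⟩
  loopless := ⟨fun p h => by simp [edge, fwd, Prod.ext_iff] at h⟩

/-- The bi-infinite sequence with value `l` at negative indices, `c` at `0` and `r` at positive
indices. -/
def window (l c r : Bool) (j : ℤ) : Bool := if j < 0 then l else if j = 0 then c else r

lemma fwd_eq_window (b : ℤ → Bool) (k s : ℤ) (e : ℤ × ℤ) (h₀ : -10 ≤ s) (h₁ : s < 20) :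
    fwd b (10 * k + s) e = fwd (window (b (k - 1)) (b k) (b (k + 1))) s e := by
  have hmod : (10 * k + s) % 10 = s % 10 := by omega
  have hdiv : (10 * k + s) / 10 = k + s / 10 := by omega
  have hb : b (k + s / 10) = window (b (k - 1)) (b k) (b (k + 1)) (s / 10) := by
    have hs : s / 10 = -1 ∨ s / 10 = 0 ∨ s / 10 = 1 := by omega
    rcases hs with h | h | h <;> rw [h] <;> simp [window, sub_eq_add_neg]
  simp only [fwd, hmod, hdiv, hb]

/-- Levels covered by a window of three consecutive strips. -/
def inWindow (s : ℤ) : Bool := decide (-10 ≤ s) && decide (s < 20)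

lemma edge_eq_window (b : ℤ → Bool) (k s : ℤ) (e : ℤ × ℤ) (h₀ : inWindow s)
    (h₁ : inWindow (s + level e)) :
    edge b (10 * k + s) e = edge (window (b (k - 1)) (b k) (b (k + 1))) s e := by
  simp only [inWindow, Bool.and_eq_true, decide_eq_true_eq] at h₀ h₁
  simp only [edge, add_assoc, fwd_eq_window b k _ _ h₀.1 h₀.2, fwd_eq_window b k _ _ h₁.1 h₁.2]

/-- The possible differences of adjacent vertices of unit length. -/
def unitSteps : List (ℤ × ℤ) := [(1, 0), (0, 1), (-1, 0), (0, -1)]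

/-- The possible differences of adjacent vertices of length `√2`. -/
def diagSteps : List (ℤ × ℤ) := [(1, -1), (-1, 1)]

lemma mem_steps_of_edge {b : ℤ → Bool} {s : ℤ} {e : ℤ × ℤ} (h : edge b s e) :
    e ∈ unitSteps ++ diagSteps := by
  simp only [edge, fwd, neg_eq_iff_eq_neg, Bool.or_eq_true, Bool.and_eq_true, beq_iff_eq] at h
  rcases h with ((⟨rfl, -⟩ | ⟨rfl, -⟩) | ⟨rfl, -⟩) | ((⟨h, -⟩ | ⟨h, -⟩) | ⟨h, -⟩) <;>
    first | decide | (rw [h]; decide)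

/-- Whether the displacement `v` can be realised from level `s`, staying in the window, by a walk
with at most `u` unit edges, at most `d` diagonal edges and at most `n` edges altogether. Displacements
with `u < |v.1 + v.2|` or `u + d < |v.1|` are out of reach and are discarded at once. -/
def reach (w : ℤ → Bool) : ℕ → ℕ → ℕ → ℤ → ℤ × ℤ → Bool
  | 0, _, _, _, v => v == 0
  | n + 1, u, d, s, v => v == 0 ||
    Nat.ble (v.1 + v.2).natAbs u && Nat.ble v.1.natAbs (u + d) &&
    ((u != 0 && unitSteps.any fun e =>
      edge w s e && inWindow (s + level e) && reach w n (u - 1) d (s + level e) (v - e)) ||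
    (d != 0 && diagSteps.any fun e =>
      edge w s e && inWindow (s + level e) && reach w n u (d - 1) (s + level e) (v - e)))

lemma dist_toC (p q : ℤ × ℤ) :
    dist (toC p) (toC q) = √(((q - p).1 ^ 2 + (q - p).2 ^ 2 : ℤ) : ℝ) := by
  rw [Complex.dist_eq_re_im]
  congr 1
  simp only [toC, Prod.fst_sub, Prod.snd_sub]
  push_cast
  ring

lemma dist_toC_unit {p e : ℤ × ℤ} (he : e ∈ unitSteps) : dist (toC p) (toC (p + e)) = 1 := by
  rw [dist_toC, add_sub_cancel_left]
  simp only [unitSteps, List.mem_cons, List.not_mem_nil, or_false] at he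
  rcases he with rfl | rfl | rfl | rfl <;> norm_num

lemma dist_toC_diag {p e : ℤ × ℤ} (he : e ∈ diagSteps) : dist (toC p) (toC (p + e)) = √2 := by
  rw [dist_toC, add_sub_cancel_left]
  simp only [diagSteps, List.mem_cons, List.not_mem_nil, or_false] at he
  rcases he with rfl | rfl <;> norm_num

lemma exists_walk_of_reach (b : ℤ → Bool) (k : ℤ) (n : ℕ) :
    ∀ (u d : ℕ) (s : ℤ) (v p : ℤ × ℤ), inWindow s → level p = 10 * k + s →
      reach (window (b (k - 1)) (b k) (b (k + 1))) n u d s v →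
      ∃ w : (stripGraph b).Walk p (p + v), walkLen _ w ≤ u + d * √2 := by
  have nil_case : ∀ (u d : ℕ) (p : ℤ × ℤ),
      ∃ w : (stripGraph b).Walk p (p + 0), walkLen _ w ≤ u + d * √2 := fun u d p => by
    rw [add_zero]
    exact ⟨.nil, by simp only [walkLen]; positivity⟩
  induction n with
  | zero =>
    intro u d s v p _ _ h
    simp only [reach, beq_iff_eq] at h
    subst h
    exact nil_case u d p
  | succ n ih =>
    intro u d s v p hs hp h
    have step : ∀ (u' d' : ℕ) (e : ℤ × ℤ), edge (window (b (k - 1)) (b k) (b (k + 1))) s e →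
        inWindow (s + level e) →
        reach (window (b (k - 1)) (b k) (b (k + 1))) n u' d' (s + level e) (v - e) →
        ∃ w : (stripGraph b).Walk p (p + v),
          walkLen _ w ≤ dist (toC p) (toC (p + e)) + (u' + d' * √2) := fun u' d' e he hin hr => by
      have hadj : (stripGraph b).Adj p (p + e) := by
        change edge b (level p) (p + e - p) = true
        rwa [hp, add_sub_cancel_left, edge_eq_window b k s e hs hin]
      have hv : p + e + (v - e) = p + v := by abel
      obtain ⟨w, hw⟩ := hv ▸ ih u' d' (s + level e) (v - e) (p + e) hin
        (by simp only [level, Prod.fst_add, Prod.snd_add] at hp ⊢; linarith) hr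
      exact ⟨.cons hadj w, by simp only [walkLen]; gcongr⟩
    simp only [reach, Bool.or_eq_true, Bool.and_eq_true, beq_iff_eq, bne_iff_ne, ne_eq,
      List.any_eq_true] at h
    rcases h with rfl | ⟨⟨-, -⟩, ⟨hu, e, he, ⟨hedge, hin⟩, hr⟩ | ⟨hd, e, he, ⟨hedge, hin⟩, hr⟩⟩
    · exact nil_case u d p
    · obtain ⟨w, hw⟩ := step _ _ e hedge hin hr
      refine ⟨w, hw.trans_eq ?_⟩
      rw [dist_toC_unit he, Nat.cast_pred (Nat.pos_of_ne_zero hu)]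
      ring
    · obtain ⟨w, hw⟩ := step _ _ e hedge hin hr
      refine ⟨w, hw.trans_eq ?_⟩
      rw [dist_toC_diag he, Nat.cast_pred (Nat.pos_of_ne_zero hd)]
      ring

/-- Admissible numbers of unit and diagonal edges for a displacement of squared length `n`. -/
def budgets (n : ℤ) : List (ℕ × ℕ) :=
  if n = 0 then [(0, 0)] else if n = 1 then [(1, 1)] else if n = 2 then [(2, 1)]
  else if n = 4 then [(2, 2)] else if n = 5 then [(3, 1), (2, 2), (1, 3), (5, 0)] else []

lemma budget_le {n : ℤ} {x : ℕ × ℕ} (hx : x ∈ budgets n) :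
    (x.1 + x.2 * √2 : ℝ) ≤ (1 + √2) * √(n : ℝ) := by
  have h2 : √2 ^ 2 = (2 : ℝ) := Real.sq_sqrt (by norm_num)
  have h2l : (1.414 : ℝ) ≤ √2 := Real.le_sqrt_of_sq_le (by norm_num)
  have h2u : √2 ≤ (1.415 : ℝ) := Real.sqrt_le_iff.2 (by norm_num)
  have h5 : (2.236 : ℝ) ≤ √5 := Real.le_sqrt_of_sq_le (by norm_num)
  have h4 : √4 = (2 : ℝ) := by
    rw [show (4 : ℝ) = 2 ^ 2 by norm_num, Real.sqrt_sq (by norm_num)]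
  have h5' : (1 + √2) * (2.236 : ℝ) ≤ (1 + √2) * √5 := by gcongr
  unfold budgets at hx
  split_ifs at hx with h h h h h
  all_goals try subst h
  all_goals simp only [List.mem_cons, List.not_mem_nil, or_false] at hx
  · subst hx; simp
  · subst hx; simp
  · subst hx; push_cast; nlinarith
  · subst hx; push_cast; rw [h4]; linarith
  · rcases hx with rfl | rfl | rfl | rfl <;> push_cast <;> linarith

/-- The lattice vectors of length at most `√5`. -/
def shortVectors : List (ℤ × ℤ) :=
  (([-2, -1, 0, 1, 2] : List ℤ) ×ˢ ([-2, -1, 0, 1, 2] : List ℤ)).filter fun v =>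
    v.1 ^ 2 + v.2 ^ 2 ≤ 5

lemma mem_shortVectors {v : ℤ × ℤ} (hv : v.1 ^ 2 + v.2 ^ 2 ≤ 5) : v ∈ shortVectors := by
  have h1 : v.1 < 3 ∧ -3 < v.1 := ⟨by nlinarith, by nlinarith⟩
  have h2 : v.2 < 3 ∧ -3 < v.2 := ⟨by nlinarith, by nlinarith⟩
  refine List.mem_filter.2 ⟨List.mem_product.2 ⟨?_, ?_⟩, decide_eq_true hv⟩ <;>
    simp only [List.mem_cons, List.not_mem_nil, or_false] <;> omega

lemma window_reach : ∀ l c r : Bool, ((List.range 10).all fun s => shortVectors.all fun v =>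
    (budgets (v.1 ^ 2 + v.2 ^ 2)).any fun x =>
      reach (window l c r) (x.1 + x.2) x.1 x.2 s v) = true := by
  decide +kernel

lemma window_degree : ∀ l c r : Bool, ∀ s ∈ List.range 10,
    ((unitSteps ++ diagSteps).filter (edge (window l c r) s)).length ≤ 3 ∧
    ∀ e ∈ unitSteps ++ diagSteps, inWindow (s + level e) := by
  decide +kernel

lemma exists_level_eq (p : ℤ × ℤ) : ∃ k : ℤ, ∃ s ∈ List.range 10, level p = 10 * k + s :=
  ⟨level p / 10, (level p % 10).toNat, by rw [List.mem_range]; omega, by omega⟩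

lemma inWindow_of_mem_range {s : ℕ} (hs : s ∈ List.range 10) : inWindow s := by
  rw [List.mem_range] at hs
  simp only [inWindow, Bool.and_eq_true, decide_eq_true_eq]
  omega

lemma gdist_stripGraph_le (b : ℤ → Bool) (p q : ℤ × ℤ) (h : dist (toC p) (toC q) ≤ √5) :
    gdist (stripGraph b) p q ≤ ENNReal.ofReal ((1 + √2) * dist (toC p) (toC q)) := by
  obtain ⟨v, rfl⟩ : ∃ v, q = p + v := ⟨q - p, by abel⟩
  rw [dist_toC, add_sub_cancel_left] at h ⊢
  have hv : v.1 ^ 2 + v.2 ^ 2 ≤ 5 := by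
    have := (Real.sqrt_le_sqrt_iff (by norm_num : (0 : ℝ) ≤ 5)).1 h
    exact_mod_cast this
  obtain ⟨k, s, hs, hp⟩ := exists_level_eq p
  have hr := window_reach (b (k - 1)) (b k) (b (k + 1))
  simp only [List.all_eq_true, List.any_eq_true] at hr
  obtain ⟨x, hx, hr⟩ := hr s hs v (mem_shortVectors hv)
  obtain ⟨w, hw⟩ := exists_walk_of_reach b k _ _ _ _ _ p (inWindow_of_mem_range hs) hp hr
  exact (iInf_le _ w).trans (ENNReal.ofReal_le_ofReal (hw.trans (budget_le hx)))

lemma maxDegThree_stripGraph (b : ℤ → Bool) : MaxDegThree (stripGraph b) := by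
  intro p
  obtain ⟨k, s, hs, hp⟩ := exists_level_eq p
  obtain ⟨hcard, hin⟩ := window_degree (b (k - 1)) (b k) (b (k + 1)) s hs
  set L := (unitSteps ++ diagSteps).filter (edge (window (b (k - 1)) (b k) (b (k + 1))) s)
  have hsub : (stripGraph b).neighborSet p ⊆ ((L.map (p + ·)).toFinset : Set (ℤ × ℤ)) := by
    intro q hq
    change edge b (level p) (q - p) = true at hq
    have hmem := mem_steps_of_edge hq
    rw [hp, edge_eq_window b k s _ (inWindow_of_mem_range hs) (hin _ hmem)] at hq
    simp only [List.coe_toFinset, List.mem_map, Set.mem_ofPred_eq]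
    exact ⟨q - p, List.mem_filter.2 ⟨hmem, hq⟩, by abel⟩
  refine (Set.encard_le_encard hsub).trans ?_
  rw [Set.encard_coe_eq_coe_finsetCard]
  exact_mod_cast (List.toFinset_card_le _).trans (by rwa [List.length_map])

/-- Each edge of a strip graph is an edge of the sheared triangular lattice. -/
lemma exists_fwd_of_adj {b : ℤ → Bool} {p q : ℤ × ℤ} (h : (stripGraph b).Adj p q) :
    ∃ a e : ℤ × ℤ, (e = (1, 0) ∨ e = (0, 1) ∨ e = (1, -1)) ∧ s(p, q) = s(a, a + e) := by
  change edge b (level p) (q - p) = true at h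
  simp only [edge, fwd, neg_sub, Bool.or_eq_true, Bool.and_eq_true, beq_iff_eq] at h
  rcases h with ((⟨h, -⟩ | ⟨h, -⟩) | ⟨h, -⟩) | ((⟨h, -⟩ | ⟨h, -⟩) | ⟨h, -⟩)
  iterate 3 exact ⟨p, q - p, by simp [h], by simp⟩
  iterate 3 exact ⟨q, p - q, by simp [h], by simp [Sym2.eq_swap]⟩

lemma exists_param_of_mem_segment {a e : ℤ × ℤ} {x : ℂ}
    (h : x ∈ segment ℝ (toC a) (toC (a + e))) :
    ∃ t : ℝ, 0 ≤ t ∧ t ≤ 1 ∧ x.re = a.1 + t * e.1 ∧ x.im = a.2 + t * e.2 := by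
  rw [segment_eq_image'] at h
  obtain ⟨t, ⟨h0, h1⟩, rfl⟩ := h
  exact ⟨t, h0, h1, by simp [toC], by simp [toC]⟩

lemma mem_endpoints {a e : ℤ × ℤ} {x : ℂ} {t : ℝ} (hre : x.re = a.1 + t * e.1)
    (him : x.im = a.2 + t * e.2) (ht : t = 0 ∨ t = 1) :
    x ∈ ({toC a, toC (a + e)} : Set ℂ) := by
  rcases ht with rfl | rfl
  · exact Or.inl (Complex.ext (by simp [toC, hre]) (by simp [toC, him]))
  · exact Or.inr (Complex.ext (by simp [toC, hre]) (by simp [toC, him]))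

lemma eq_zero_or_one_of_eq_intCast {t : ℝ} (h0 : 0 ≤ t) (h1 : t ≤ 1) (n : ℤ) (h : t = n) :
    t = 0 ∨ t = 1 := by
  subst h
  have h0' : 0 ≤ n := by exact_mod_cast h0
  have h1' : n ≤ 1 := by exact_mod_cast h1
  obtain rfl | rfl : n = 0 ∨ n = 1 := by omega
  · simp
  · simp

lemma eq_zero_or_one_of_sub_eq_intCast {s t : ℝ} (hs0 : 0 ≤ s) (hs1 : s ≤ 1) (ht0 : 0 ≤ t)
    (ht1 : t ≤ 1) (n : ℤ) (hn : n ≠ 0) (h : s - t = n) :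
    (s = 0 ∨ s = 1) ∧ (t = 0 ∨ t = 1) := by
  have h0 : (-1 : ℝ) ≤ n := by linarith
  have h1 : (n : ℝ) ≤ 1 := by linarith
  have h0' : -1 ≤ n := by exact_mod_cast h0
  have h1' : n ≤ 1 := by exact_mod_cast h1
  obtain rfl | rfl : n = -1 ∨ n = 1 := by omega
  · push_cast at h
    exact ⟨Or.inl (by linarith), Or.inr (by linarith)⟩
  · push_cast at h
    exact ⟨Or.inr (by linarith), Or.inl (by linarith)⟩

/-- The edges of the sheared triangular lattice only meet in common endpoints. -/
lemma triangular_plane {a e c f : ℤ × ℤ} (he : e = (1, 0) ∨ e = (0, 1) ∨ e = (1, -1))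
    (hf : f = (1, 0) ∨ f = (0, 1) ∨ f = (1, -1)) (hne : (a, e) ≠ (c, f)) {s t : ℝ}
    (hs0 : 0 ≤ s) (hs1 : s ≤ 1) (ht0 : 0 ≤ t) (ht1 : t ≤ 1)
    (hre : (a.1 + s * e.1 : ℝ) = c.1 + t * f.1) (him : (a.2 + s * e.2 : ℝ) = c.2 + t * f.2) :
    (s = 0 ∨ s = 1) ∧ (t = 0 ∨ t = 1) := by
  obtain ⟨a₁, a₂⟩ := a
  obtain ⟨c₁, c₂⟩ := c
  rcases he with rfl | rfl | rfl <;> rcases hf with rfl | rfl | rfl <;>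
    simp only [Int.cast_zero, Int.cast_one, Int.cast_neg, mul_zero, mul_one, add_zero, mul_neg]
      at hre him
  · refine eq_zero_or_one_of_sub_eq_intCast hs0 hs1 ht0 ht1 (c₁ - a₁) (fun h => hne ?_)
      (by push_cast; linarith)
    have : a₂ = c₂ := by exact_mod_cast him
    simp [this, show a₁ = c₁ by omega]
  · exact ⟨eq_zero_or_one_of_eq_intCast hs0 hs1 (c₁ - a₁) (by push_cast; linarith),
      eq_zero_or_one_of_eq_intCast ht0 ht1 (a₂ - c₂) (by push_cast; linarith)⟩
  · exact ⟨eq_zero_or_one_of_eq_intCast hs0 hs1 (c₁ - a₁ + c₂ - a₂) (by push_cast; linarith),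
      eq_zero_or_one_of_eq_intCast ht0 ht1 (c₂ - a₂) (by push_cast; linarith)⟩
  · exact ⟨eq_zero_or_one_of_eq_intCast hs0 hs1 (c₂ - a₂) (by push_cast; linarith),
      eq_zero_or_one_of_eq_intCast ht0 ht1 (a₁ - c₁) (by push_cast; linarith)⟩
  · refine eq_zero_or_one_of_sub_eq_intCast hs0 hs1 ht0 ht1 (c₂ - a₂) (fun h => hne ?_)
      (by push_cast; linarith)
    have : a₁ = c₁ := by exact_mod_cast hre
    simp [this, show a₂ = c₂ by omega]
  · exact ⟨eq_zero_or_one_of_eq_intCast hs0 hs1 (c₁ - a₁ + c₂ - a₂) (by push_cast; linarith),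
      eq_zero_or_one_of_eq_intCast ht0 ht1 (a₁ - c₁) (by push_cast; linarith)⟩
  · exact ⟨eq_zero_or_one_of_eq_intCast hs0 hs1 (a₂ - c₂) (by push_cast; linarith),
      eq_zero_or_one_of_eq_intCast ht0 ht1 (a₁ - c₁ + a₂ - c₂) (by push_cast; linarith)⟩
  · exact ⟨eq_zero_or_one_of_eq_intCast hs0 hs1 (c₁ - a₁) (by push_cast; linarith),
      eq_zero_or_one_of_eq_intCast ht0 ht1 (a₁ - c₁ + a₂ - c₂) (by push_cast; linarith)⟩
  · refine eq_zero_or_one_of_sub_eq_intCast hs0 hs1 ht0 ht1 (c₁ - a₁) (fun h => hne ?_)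
      (by push_cast; linarith)
    have h' : (a₁ + a₂ : ℝ) = c₁ + c₂ := by linarith
    have h'' : a₁ + a₂ = c₁ + c₂ := by exact_mod_cast h'
    simp [show a₁ = c₁ by omega, show a₂ = c₂ by omega]

lemma segment_and_pair_eq {p q a a' : ℤ × ℤ} (h : s(p, q) = s(a, a')) :
    segment ℝ (toC p) (toC q) = segment ℝ (toC a) (toC a') ∧
      ({toC p, toC q} : Set ℂ) = {toC a, toC a'} := by
  rcases Sym2.eq_iff.1 h with ⟨rfl, rfl⟩ | ⟨rfl, rfl⟩
  · exact ⟨rfl, rfl⟩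
  · exact ⟨segment_symm _ _ _, Set.pair_comm _ _⟩

lemma isPlane_stripGraph (b : ℤ → Bool) : IsPlane (stripGraph b) := by
  intro p q p' q' h h' hne x hx hx'
  obtain ⟨a, e, he, hs⟩ := exists_fwd_of_adj h
  obtain ⟨c, f, hf, hs'⟩ := exists_fwd_of_adj h'
  rw [(segment_and_pair_eq hs).1] at hx
  rw [(segment_and_pair_eq hs').1] at hx'
  rw [(segment_and_pair_eq hs).2, (segment_and_pair_eq hs').2]
  obtain ⟨s, hs0, hs1, hre, him⟩ := exists_param_of_mem_segment hx
  obtain ⟨t, ht0, ht1, hre', him'⟩ := exists_param_of_mem_segment hx'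
  have hne' : (a, e) ≠ (c, f) := fun heq => by
    obtain ⟨rfl, rfl⟩ := Prod.mk.inj heq
    exact hne (hs.trans hs'.symm)
  obtain ⟨hs2, ht2⟩ := triangular_plane he hf hne' hs0 hs1 ht0 ht1 (hre.symm.trans hre')
    (him.symm.trans him')
  exact ⟨mem_endpoints hre him hs2, mem_endpoints hre' him' ht2⟩

lemma locallyOptimal_stripGraph (b : ℤ → Bool) : LocallyOptimal (stripGraph b) :=
  ⟨isPlane_stripGraph b, maxDegThree_stripGraph b, gdist_stripGraph_le b⟩

lemma stripGraph_adj_iff (b : ℤ → Bool) (k : ℤ) :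
    (stripGraph b).Adj (10 * k + 1, 0) (10 * k + 2, 0) ↔ b k = true := by
  have hmod : (10 * k + 1) % 10 = 1 := by omega
  have hdiv : (10 * k + 1) / 10 = k := by omega
  have he : ((10 * k + 2, 0) - (10 * k + 1, 0) : ℤ × ℤ) = (1, 0) := by
    ext <;> simp
  change edge b (level (10 * k + 1, 0)) _ = true ↔ _
  rw [he]
  simp [edge, fwd, level, hmod, hdiv]

lemma stripGraph_injective : Function.Injective stripGraph := fun b b' h => by
  funext k
  rw [Bool.eq_iff_iff, ← stripGraph_adj_iff, ← stripGraph_adj_iff, h]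

end ShearedStrips

open ShearedStrips in
/-- There are uncountably many locally optimal geometric graphs on ℤ²
(at least 2^ℵ₀ many). -/
theorem uncountably_many_locally_optimal :
    ¬ ({G : SimpleGraph (ℤ × ℤ) | LocallyOptimal G}.Countable) ∧
    Cardinal.continuum ≤ Cardinal.mk {G : SimpleGraph (ℤ × ℤ) | LocallyOptimal G} := by
  have key : Cardinal.continuum ≤
      Cardinal.mk {G : SimpleGraph (ℤ × ℤ) | LocallyOptimal G} := by
    have hmk : Cardinal.mk (ℤ → Bool) = Cardinal.continuum := by simp
    rw [← hmk]
    exact Cardinal.mk_le_of_injective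
      (f := fun b => (⟨stripGraph b, locallyOptimal_stripGraph b⟩ :
        {G : SimpleGraph (ℤ × ℤ) | LocallyOptimal G}))
      fun b b' h => stripGraph_injective (congrArg Subtype.val h)
  refine ⟨fun hc => ?_, key⟩
  exact (key.trans (Cardinal.le_aleph0_iff_set_countable.2 hc)).not_gt Cardinal.aleph0_lt_continuum
end

section
/- There are uncountably many plane geometric graphs on ℤ² of maximum degree at most 3 whose dilation equals 1+√2. -/
open SimpleGraph ENNReal

/-! ### Lengths of walks -/

section WalkLength

variable {G : SimpleGraph (ℤ × ℤ)}

theorem dist_toC (p q : ℤ × ℤ) :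
    Dist.dist (toC p) (toC q) = √(((q.1 - p.1 : ℤ) : ℝ) ^ 2 + ((q.2 - p.2 : ℤ) : ℝ) ^ 2) := by
  rw [_root_.dist_comm, Complex.dist_eq_re_im]
  simp [toC]

theorem walkLen_append {p q r : ℤ × ℤ} (w : G.Walk p q) (w' : G.Walk q r) :
    walkLen G (w.append w') = walkLen G w + walkLen G w' := by
  induction w with
  | nil => simp [walkLen]
  | cons h w ih => simp [walkLen, ih, add_assoc]

theorem walkLen_reverse {p q : ℤ × ℤ} (w : G.Walk p q) :
    walkLen G w.reverse = walkLen G w := by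
  induction w with
  | nil => simp [walkLen]
  | cons h w ih =>
    simp only [Walk.reverse_cons, walkLen_append, ih, walkLen, add_zero]
    rw [_root_.dist_comm, add_comm]

theorem dist_le_walkLen {p q : ℤ × ℤ} (w : G.Walk p q) :
    Dist.dist (toC p) (toC q) ≤ walkLen G w := by
  induction w with
  | nil => simp [walkLen]
  | cons h w ih => exact (_root_.dist_triangle _ _ _).trans (add_le_add_right ih _)

/-- Any two vertices whose difference is `v` are joined by a walk of length at most `c`. -/
def Reaches (G : SimpleGraph (ℤ × ℤ)) (v : ℤ × ℤ) (c : ℝ) : Prop :=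
  ∀ p, ∃ w : G.Walk p (p + v), walkLen G w ≤ c

theorem Reaches.zero : Reaches G 0 0 := fun p =>
  ⟨Walk.nil.copy rfl (add_zero p).symm, by
    have key : ∀ q (h : p = q), walkLen G ((Walk.nil : G.Walk p p).copy rfl h) ≤ 0 := by
      rintro q rfl; simp [walkLen]
    exact key _ _⟩

theorem Reaches.add {v v' : ℤ × ℤ} {c c' : ℝ} (h : Reaches G v c) (h' : Reaches G v' c') :
    Reaches G (v + v') (c + c') := by
  intro p
  obtain ⟨w, hw⟩ := h p
  obtain ⟨w', hw'⟩ := h' (p + v)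
  rw [← add_assoc]
  exact ⟨w.append w', by rw [walkLen_append]; exact add_le_add hw hw'⟩

theorem Reaches.neg {v : ℤ × ℤ} {c : ℝ} (h : Reaches G v c) : Reaches G (-v) c := by
  intro p
  have := h (p + -v)
  rw [neg_add_cancel_right] at this
  obtain ⟨w, hw⟩ := this
  exact ⟨w.reverse, by rwa [walkLen_reverse]⟩

theorem Reaches.nsmul {v : ℤ × ℤ} {c : ℝ} (h : Reaches G v c) (n : ℕ) :
    Reaches G (n • v) (n * c) := by
  induction n with
  | zero => simpa using Reaches.zero
  | succ n ih => simpa [succ_nsmul, add_mul] using ih.add h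

theorem Reaches.mono {v : ℤ × ℤ} {c c' : ℝ} (h : Reaches G v c) (hc : c ≤ c') :
    Reaches G v c' := fun p => (h p).imp fun _ hw => hw.trans hc

/-- In an octant, a displacement is a combination of a knight's move and either a unit vector or a
diagonal vector, whose costs add up to at most `1 + √2` times the Euclidean norm. -/
theorem Reaches.octant {e f : ℤ × ℤ} (h₁ : Reaches G e (1 + √2)) (h₂ : Reaches G (e + f) (2 + √2))
    (h₃ : Reaches G (2 • e + f) (3 + √2)) {a b : ℕ} (hab : b ≤ a) :
    Reaches G (a • e + b • f) ((1 + √2) * √((a : ℝ) ^ 2 + (b : ℝ) ^ 2)) := by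
  have s2 : √2 ^ 2 = (2 : ℝ) := Real.sq_sqrt (by norm_num)
  have s1 : 1 ≤ √2 := Real.one_le_sqrt.2 (by norm_num)
  rcases le_total (2 * b) a with h | h
  · obtain ⟨k, rfl⟩ := Nat.exists_eq_add_of_le h
    have := (h₃.nsmul b).add (h₁.nsmul k)
    convert this.mono ?_ using 1
    · module
    · have : ((2 * b + k : ℕ) : ℝ) ≤ √(((2 * b + k : ℕ) : ℝ) ^ 2 + (b : ℝ) ^ 2) :=
        Real.le_sqrt_of_sq_le (by nlinarith)
      have := mul_le_mul_of_nonneg_left this (by positivity : (0 : ℝ) ≤ 1 + √2)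
      have hb : (0 : ℝ) ≤ b := b.cast_nonneg
      push_cast at this ⊢
      nlinarith
  · obtain ⟨k, rfl⟩ := Nat.exists_eq_add_of_le hab
    obtain ⟨m, rfl⟩ : ∃ m, b = k + m := Nat.exists_eq_add_of_le (by omega)
    have := (h₃.nsmul k).add (h₂.nsmul m)
    convert this.mono ?_ using 1
    · module
    · have hk : (0 : ℝ) ≤ k := k.cast_nonneg
      have hm : (0 : ℝ) ≤ m := m.cast_nonneg
      rw [← Real.sqrt_sq (by positivity : (0 : ℝ) ≤ 1 + √2), ← Real.sqrt_mul (by positivity)]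
      apply Real.le_sqrt_of_sq_le
      push_cast
      have hp : 0 ≤ (1 + √2) * ((k : ℝ) * (k + m + k)) := by positivity
      nlinarith

/-- A graph in which unit, diagonal and knight's moves are cheap has dilation at most `1 + √2`. -/
theorem dil_le_of_reaches
    (hx : Reaches G (1, 0) (1 + √2)) (hy : Reaches G (0, 1) (1 + √2))
    (hd : Reaches G (1, 1) (2 + √2)) (hd' : Reaches G (1, -1) (2 + √2))
    (hk₁ : Reaches G (2, 1) (3 + √2)) (hk₂ : Reaches G (1, 2) (3 + √2))
    (hk₃ : Reaches G (2, -1) (3 + √2)) (hk₄ : Reaches G (1, -2) (3 + √2)) :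
    dil G ≤ ENNReal.ofReal (1 + √2) := by
  have key : ∀ v : ℤ × ℤ, Reaches G v ((1 + √2) * √((v.1 : ℝ) ^ 2 + (v.2 : ℝ) ^ 2)) := by
    have half : ∀ (a : ℕ) (b : ℤ),
        Reaches G ((a : ℤ), b) ((1 + √2) * √(((a : ℤ) : ℝ) ^ 2 + (b : ℝ) ^ 2)) := by
      intro a b
      obtain ⟨b, rfl | rfl⟩ := b.eq_nat_or_neg <;> rcases le_total b a with h | h
      · simpa using Reaches.octant (f := (0, 1)) hx hd hk₁ h
      · simpa [add_comm] using Reaches.octant (f := (1, 0)) hy hd hk₂ h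
      · simpa using Reaches.octant (e := (1, 0)) (f := (0, -1)) hx (by simpa using hd')
          (by simpa using hk₃) h
      · simpa [add_comm] using
          Reaches.octant (e := (0, -1)) (f := (1, 0)) hy.neg hd' hk₄ h
    rintro ⟨a, b⟩
    obtain ⟨a, rfl | rfl⟩ := a.eq_nat_or_neg
    · exact half a b
    · simpa using (half a (-b)).neg
  refine iSup_le fun p => iSup_le fun q => iSup_le fun hpq => ENNReal.div_le_of_le_mul ?_
  rw [← ENNReal.ofReal_mul (by positivity)]
  have := key (q - p) p
  rw [add_sub_cancel] at this
  obtain ⟨w, hw⟩ := this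
  exact iInf_le_of_le w (ENNReal.ofReal_le_ofReal (by rw [dist_toC]; exact hw))

end WalkLength

/-! ### Subgraphs of the triangular lattice are plane -/

theorem isPlane_of_adj {G : SimpleGraph (ℤ × ℤ)}
    (hG : ∀ p q, G.Adj p q → q - p ∈ ({(1, 0), (0, 1), (1, 1)} : Set (ℤ × ℤ)) ∨
      p - q ∈ ({(1, 0), (0, 1), (1, 1)} : Set (ℤ × ℤ))) : IsPlane G := by
  have key : ∀ a b c d : ℤ × ℤ, b - a ∈ ({(1, 0), (0, 1), (1, 1)} : Set (ℤ × ℤ)) →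
      d - c ∈ ({(1, 0), (0, 1), (1, 1)} : Set (ℤ × ℤ)) → s(a, b) ≠ s(c, d) →
      ∀ x : ℂ, x ∈ segment ℝ (toC a) (toC b) → x ∈ segment ℝ (toC c) (toC d) →
        x ∈ ({toC a, toC b} : Set ℂ) ∧ x ∈ ({toC c, toC d} : Set ℂ) := by
    intro a b c d hab hcd hne x hx hx'
    obtain ⟨v, rfl⟩ : ∃ v, b = a + v := ⟨b - a, by simp⟩
    obtain ⟨v', rfl⟩ : ∃ v', d = c + v' := ⟨d - c, by simp⟩
    rw [add_sub_cancel_left] at hab hcd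
    rw [segment_eq_image'] at hx hx'
    obtain ⟨t, ht, rfl⟩ := hx
    obtain ⟨u, hu, hut⟩ := hx'
    have toC_add (p q : ℤ × ℤ) : toC (p + q) = toC p + toC q := by
      simp [toC, Complex.ext_iff]
    simp only [toC_add, add_sub_cancel_left] at hut ⊢
    have mem_pair {p w : ℂ} {θ : ℝ} (h : θ = 0 ∨ θ = 1) : p + θ • w ∈ ({p, p + w} : Set ℂ) := by
      rcases h with rfl | rfl <;> simp
    suffices (t = 0 ∨ t = 1) ∧ (u = 0 ∨ u = 1) from
      ⟨mem_pair this.1, hut ▸ mem_pair this.2⟩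
    have of_int {θ : ℝ} (hθ : θ ∈ Set.Icc (0 : ℝ) 1) (z : ℤ) (hz : θ = z) : θ = 0 ∨ θ = 1 := by
      have h₀ : (0 : ℝ) ≤ z := hz ▸ hθ.1
      have h₁ : (z : ℝ) ≤ 1 := hz ▸ hθ.2
      norm_cast at h₀ h₁
      obtain rfl | rfl : z = 0 ∨ z = 1 := by omega
      all_goals simp [hz]
    have hre : (c.1 : ℝ) + u * v'.1 = a.1 + t * v.1 := by simpa [toC] using congrArg Complex.re hut
    have him : (c.2 : ℝ) + u * v'.2 = a.2 + t * v.2 := by simpa [toC] using congrArg Complex.im hut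
    have parallel (z : ℤ) (hz : (z : ℝ) = u - t) (h : z ≠ 0) :
        (t = 0 ∨ t = 1) ∧ (u = 0 ∨ u = 1) := by
      have h₀ : (-1 : ℝ) ≤ z := by linarith [hu.1, ht.2]
      have h₁ : (z : ℝ) ≤ 1 := by linarith [hu.2, ht.1]
      norm_cast at h₀ h₁
      obtain rfl | rfl : z = -1 ∨ z = 1 := by omega
      all_goals push_cast at hz
      · exact ⟨.inr (by linarith [hu.1, ht.2]), .inl (by linarith [hu.1, ht.2])⟩
      · exact ⟨.inl (by linarith [hu.2, ht.1]), .inr (by linarith [hu.2, ht.1])⟩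
    rcases hab with rfl | rfl | rfl <;> rcases hcd with rfl | rfl | rfl <;>
      norm_num at hre him
    · refine parallel (a.1 - c.1) (by push_cast; linarith) fun h => hne ?_
      rw [show a = c from Prod.ext (sub_eq_zero.1 h) him.symm]
    · exact ⟨of_int ht (c.1 - a.1) (by push_cast; linarith),
        of_int hu (a.2 - c.2) (by push_cast; linarith)⟩
    · exact ⟨of_int ht (c.1 - a.1 + a.2 - c.2) (by push_cast; linarith),
        of_int hu (a.2 - c.2) (by push_cast; linarith)⟩
    · exact ⟨of_int ht (c.2 - a.2) (by push_cast; linarith),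
        of_int hu (a.1 - c.1) (by push_cast; linarith)⟩
    · refine parallel (a.2 - c.2) (by push_cast; linarith) fun h => hne ?_
      rw [show a = c from Prod.ext hre.symm (sub_eq_zero.1 h)]
    · exact ⟨of_int ht (c.2 - a.2 + a.1 - c.1) (by push_cast; linarith),
        of_int hu (a.1 - c.1) (by push_cast; linarith)⟩
    · exact ⟨of_int ht (c.2 - a.2) (by push_cast; linarith),
        of_int hu (a.1 - c.1 + c.2 - a.2) (by push_cast; linarith)⟩
    · exact ⟨of_int ht (c.1 - a.1) (by push_cast; linarith),
        of_int hu (a.2 - c.2 + c.1 - a.1) (by push_cast; linarith)⟩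
    · refine parallel (a.1 - c.1) (by push_cast; linarith) fun h => hne ?_
      have h' : ((a.1 - c.1 : ℤ) : ℝ) = (a.2 - c.2 : ℤ) := by push_cast; linarith
      rw [Int.cast_inj, h, eq_comm] at h'
      rw [show a = c from Prod.ext (sub_eq_zero.1 h) (sub_eq_zero.1 h')]
  intro a b c d hab hcd hne x hx hx'
  rcases hG a b hab with h | h <;> rcases hG c d hcd with h' | h'
  · exact key a b c d h h' hne x hx hx'
  · rw [Set.pair_comm (toC c)]
    rw [segment_symm] at hx'
    rw [Sym2.eq_swap (a := c)] at hne
    exact key a b d c h h' hne x hx hx'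
  · rw [Set.pair_comm (toC a)]
    rw [segment_symm] at hx
    rw [Sym2.eq_swap (a := a)] at hne
    exact key b a c d h h' hne x hx hx'
  · rw [Set.pair_comm (toC a), Set.pair_comm (toC c)]
    rw [segment_symm] at hx hx'
    rw [Sym2.eq_swap (a := a), Sym2.eq_swap (a := c)] at hne
    exact key b a d c h h' hne x hx hx'

/-! ### The family of graphs -/

/-- Whether the edge from `p` to `q` directed right, up, or up-right is present. The lattice is cut
into blocks of three rows; the graph has period `4` in each row, consecutive blocks are shifted by
`2`, and `s j` chooses one of two ways to draw the block `j`. -/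
def outEdge (s : ℤ → Bool) (p q : ℤ × ℤ) : Bool :=
  let j := p.2 / 3
  let c := (p.1 - 2 * j) % 4
  let r := p.2 % 3
  (q.2 == p.2 && q.1 == p.1 + 1 &&
    (if r = 0 then c == 0 || c == 2
    else if r = 1 then c == 2 || c == 3 || (c == 1 && !s j)
    else c == 0 || c == 3 || (c == 1 && !s j))) ||
  (q.2 == p.2 + 1 && q.1 == p.1 &&
    (if r = 0 then c == 0 || c == 2
    else if r = 1 then (c == 1 || c == 2) && s j
    else c == 1 || c == 3)) ||
  (q.2 == p.2 + 1 && q.1 == p.1 + 1 &&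
    (if r = 0 then c == 0 || c == 3
    else if r = 1 then c == 1 || c == 3
    else c == 2 || c == 3))

theorem sub_mem_of_outEdge {s : ℤ → Bool} {p q : ℤ × ℤ} (h : outEdge s p q) :
    q - p ∈ ({(1, 0), (0, 1), (1, 1)} : Set (ℤ × ℤ)) := by
  simp only [outEdge, Bool.or_eq_true, Bool.and_eq_true, beq_iff_eq] at h
  simp only [Set.mem_insert_iff, Set.mem_singleton_iff, Prod.ext_iff, Prod.fst_sub, Prod.snd_sub]
  omega

/-- The graph with block choices `s`. -/
def blockGraph (s : ℤ → Bool) : SimpleGraph (ℤ × ℤ) where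
  Adj p q := outEdge s p q || outEdge s q p
  symm := ⟨fun p q h => by rwa [Bool.or_comm]⟩
  loopless := ⟨fun p h => by
    rw [Bool.or_self] at h
    simpa [Prod.ext_iff] using sub_mem_of_outEdge h⟩

theorem sub_mem_of_adj {s : ℤ → Bool} {p q : ℤ × ℤ} (h : (blockGraph s).Adj p q) :
    q - p ∈ ({(1, 0), (0, 1), (1, 1)} : Set (ℤ × ℤ)) ∨
      p - q ∈ ({(1, 0), (0, 1), (1, 1)} : Set (ℤ × ℤ)) :=
  ((Bool.or_eq_true _ _).mp h).imp sub_mem_of_outEdge sub_mem_of_outEdge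

/-- The choices `b₀`, `b₁`, `b₂` for the blocks `-1`, `0`, `1`. -/
def window (b₀ b₁ b₂ : Bool) (j : ℤ) : Bool :=
  if j < 0 then b₀ else if j = 0 then b₁ else b₂

/-- Adjacency of vertices in the three blocks `-1`, `0`, `1`. -/
def windowAdj (b₀ b₁ b₂ : Bool) (p q : ℤ × ℤ) : Bool :=
  decide (-3 ≤ p.2) && decide (p.2 < 6) && decide (-3 ≤ q.2) && decide (q.2 < 6) &&
    (outEdge (window b₀ b₁ b₂) p q || outEdge (window b₀ b₁ b₂) q p)

theorem outEdge_translate (s : ℤ → Bool) (i j : ℤ) {p q : ℤ × ℤ} (h : -3 ≤ p.2) (h' : p.2 < 6) :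
    outEdge s (p + (4 * i + 2 * j, 3 * j)) (q + (4 * i + 2 * j, 3 * j)) =
      outEdge (window (s (j - 1)) (s j) (s (j + 1))) p q := by
  obtain ⟨x, y⟩ := p
  obtain ⟨x', y'⟩ := q
  have e₁ : (y + 3 * j) / 3 = y / 3 + j := by omega
  have e₂ : (x + (4 * i + 2 * j) - 2 * (y / 3 + j)) % 4 = (x - 2 * (y / 3)) % 4 := by omega
  have e₃ : (y + 3 * j) % 3 = y % 3 := by omega
  have e₄ : s (y / 3 + j) = window (s (j - 1)) (s j) (s (j + 1)) (y / 3) := by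
    have : y / 3 = -1 ∨ y / 3 = 0 ∨ y / 3 = 1 := by
      simp only at h h'
      omega
    rcases this with h | h | h <;> simp [h, window, add_comm, sub_eq_add_neg]
  have e₅ (a b c : ℤ) : (a + c == b + c) = (a == b) := by
    rw [Bool.eq_iff_iff]; simp
  have e₆ (a b c : ℤ) : (a + c == b + c + 1) = (a == b + 1) := by
    rw [add_right_comm, e₅]
  simp only [outEdge, Prod.mk_add_mk, e₁, e₂, e₃, e₄, e₅, e₆]

theorem adj_translate_iff (s : ℤ → Bool) (i j : ℤ) {p q : ℤ × ℤ} (hp : -3 ≤ p.2) (hp' : p.2 < 6)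
    (hq : -3 ≤ q.2) (hq' : q.2 < 6) :
    (blockGraph s).Adj (p + (4 * i + 2 * j, 3 * j)) (q + (4 * i + 2 * j, 3 * j)) ↔
      windowAdj (s (j - 1)) (s j) (s (j + 1)) p q := by
  simp [blockGraph, windowAdj, outEdge_translate s i j hp hp', outEdge_translate s i j hq hq',
    hp, hp', hq, hq']

theorem exists_representative (p : ℤ × ℤ) :
    ∃ (i j : ℤ) (c : Fin 4) (r : Fin 3),
      p = (((c : ℕ) : ℤ), ((r : ℕ) : ℤ)) + (4 * i + 2 * j, 3 * j) := by
  refine ⟨(p.1 - 2 * (p.2 / 3)) / 4, p.2 / 3, ⟨((p.1 - 2 * (p.2 / 3)) % 4).toNat, by omega⟩,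
    ⟨(p.2 % 3).toNat, by omega⟩, Prod.ext ?_ ?_⟩ <;> simp <;> omega

/-- Depth-first search for a walk from `p` to `q` with at most `n` steps, of which at most `m` have
unit length and at most `k` are diagonal. -/
def search (adj : ℤ × ℤ → ℤ × ℤ → Bool) : ℕ → ℕ → ℕ → ℤ × ℤ → ℤ × ℤ → Bool
  | 0, _, _, p, q => p == q
  | n + 1, m, k, p, q => Nat.ble ((q.1 - p.1).natAbs + (q.2 - p.2).natAbs) (m + 2 * k) &&
    (p == q ||
      (Nat.blt 0 m && [(1, 0), (0, 1), (-1, 0), (0, -1)].any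
        fun v => adj p (p + v) && search adj n (m - 1) k (p + v) q) ||
      (Nat.blt 0 k && [(1, 1), (-1, -1)].any
        fun v => adj p (p + v) && search adj n m (k - 1) (p + v) q))

theorem exists_walk_of_search {G : SimpleGraph (ℤ × ℤ)} {adj : ℤ × ℤ → ℤ × ℤ → Bool} {t : ℤ × ℤ}
    (hadj : ∀ p q, adj p q → G.Adj (p + t) (q + t)) (n m k : ℕ) (p q : ℤ × ℤ)
    (h : search adj n m k p q) : ∃ w : G.Walk (p + t) (q + t), walkLen G w ≤ m + k * √2 := by
  induction n generalizing m k p with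
  | zero =>
    obtain rfl : p = q := by simpa [search] using h
    exact ⟨Walk.nil, by simp only [walkLen]; positivity⟩
  | succ n ih =>
    simp only [search, Bool.and_eq_true, Bool.or_eq_true, List.any_eq_true, Nat.blt_eq,
      beq_iff_eq] at h
    obtain ⟨-, (rfl | ⟨hm, v, hv, ha, hs⟩) | ⟨hk, v, hv, ha, hs⟩⟩ := h
    · exact ⟨Walk.nil, by simp only [walkLen]; positivity⟩
    · obtain ⟨w, hw⟩ := ih _ _ _ hs
      refine ⟨Walk.cons (hadj _ _ ha) w, ?_⟩
      have hd : Dist.dist (toC (p + t)) (toC (p + v + t)) = 1 := by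
        rw [dist_toC]
        simp only [List.mem_cons, List.not_mem_nil, or_false] at hv
        rcases hv with rfl | rfl | rfl | rfl <;> simp [add_right_comm]
      rw [walkLen, hd]
      rw [Nat.cast_sub hm] at hw
      push_cast at hw
      linarith
    · obtain ⟨w, hw⟩ := ih _ _ _ hs
      refine ⟨Walk.cons (hadj _ _ ha) w, ?_⟩
      have hd : Dist.dist (toC (p + t)) (toC (p + v + t)) = √2 := by
        rw [dist_toC]
        simp only [List.mem_cons, List.not_mem_nil, or_false] at hv
        rcases hv with rfl | rfl <;> norm_num [add_right_comm]
      rw [walkLen, hd]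
      rw [Nat.cast_sub hk] at hw
      push_cast at hw
      linarith

/-- The search from every representative vertex succeeds for the displacement `v`. -/
def SearchSucceeds (m : ℕ) (v : ℤ × ℤ) : Prop :=
  ∀ (b₀ b₁ b₂ : Bool) (c : Fin 4) (r : Fin 3),
    (let p : ℤ × ℤ := (((c : ℕ) : ℤ), ((r : ℕ) : ℤ))
    search (windowAdj b₀ b₁ b₂) 4 m 1 p (p + v) ||
      (Nat.ble 2 m && search (windowAdj b₀ b₁ b₂) 3 (m - 2) 2 p (p + v))) = true

instance (m : ℕ) (v : ℤ × ℤ) : Decidable (SearchSucceeds m v) := by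
  unfold SearchSucceeds; infer_instance

theorem SearchSucceeds.reaches {m : ℕ} {v : ℤ × ℤ} (h : SearchSucceeds m v) (s : ℤ → Bool) :
    Reaches (blockGraph s) v (m + √2) := by
  intro p
  obtain ⟨i, j, c, r, rfl⟩ := exists_representative p
  have hadj (p q) (hpq : windowAdj (s (j - 1)) (s j) (s (j + 1)) p q) :
      (blockGraph s).Adj (p + (4 * i + 2 * j, 3 * j)) (q + (4 * i + 2 * j, 3 * j)) := by
    have := hpq
    simp only [windowAdj, Bool.and_eq_true, decide_eq_true_eq] at this
    obtain ⟨⟨⟨⟨h₁, h₂⟩, h₃⟩, h₄⟩, -⟩ := this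
    exact (adj_translate_iff s i j h₁ h₂ h₃ h₄).2 hpq
  rw [add_right_comm]
  have s2 : √2 ≤ 2 := Real.sqrt_le_sqrt (by norm_num) |>.trans (Real.sqrt_sq (by norm_num)).le
  rcases (Bool.or_eq_true _ _).mp (h (s (j - 1)) (s j) (s (j + 1)) c r) with h | h
  · obtain ⟨w, hw⟩ := exists_walk_of_search hadj _ _ _ _ _ h
    exact ⟨w, by simpa using hw⟩
  · obtain ⟨hm, h⟩ := (Bool.and_eq_true _ _).mp h
    obtain ⟨w, hw⟩ := exists_walk_of_search hadj _ _ _ _ _ h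
    refine ⟨w, hw.trans ?_⟩
    rw [Nat.cast_sub (Nat.le_of_ble_eq_true hm)]
    push_cast
    linarith

theorem dil_blockGraph_le (s : ℤ → Bool) : dil (blockGraph s) ≤ ENNReal.ofReal (1 + √2) := by
  have h₁ : SearchSucceeds 1 (1, 0) ∧ SearchSucceeds 1 (0, 1) := by decide +kernel
  have h₂ : SearchSucceeds 2 (1, 1) ∧ SearchSucceeds 2 (1, -1) := by decide +kernel
  have h₃ : SearchSucceeds 3 (2, 1) ∧ SearchSucceeds 3 (1, 2) ∧ SearchSucceeds 3 (2, -1) ∧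
      SearchSucceeds 3 (1, -2) := by decide +kernel
  refine dil_le_of_reaches ?_ ?_ ?_ ?_ ?_ ?_ ?_ ?_
  · simpa using h₁.1.reaches s
  · simpa using h₁.2.reaches s
  · simpa using h₂.1.reaches s
  · simpa using h₂.2.reaches s
  · simpa using h₃.1.reaches s
  · simpa using h₃.2.1.reaches s
  · simpa using h₃.2.2.1.reaches s
  · simpa using h₃.2.2.2.reaches s

/-! ### Degrees, the lower bound, and injectivity of the parametrization -/

theorem maxDegThree_blockGraph (s : ℤ → Bool) : MaxDegThree (blockGraph s) := by
  have key : ∀ (b₀ b₁ b₂ : Bool) (c : Fin 4) (r : Fin 3),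
      (({(1, 0), (0, 1), (1, 1), (-1, 0), (0, -1), (-1, -1)} : Finset (ℤ × ℤ)).filter fun v =>
        windowAdj b₀ b₁ b₂ (((c : ℕ) : ℤ), ((r : ℕ) : ℤ)) ((((c : ℕ) : ℤ), ((r : ℕ) : ℤ)) + v)
          ).card ≤ 3 := by
    decide +kernel
  intro p
  obtain ⟨i, j, c, r, rfl⟩ := exists_representative p
  set p : ℤ × ℤ := (((c : ℕ) : ℤ), ((r : ℕ) : ℤ)) with hp
  set t : ℤ × ℤ := (4 * i + 2 * j, 3 * j) with ht
  have := key (s (j - 1)) (s j) (s (j + 1)) c r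
  rw [← hp] at this
  refine (Set.encard_le_encard (t := (· + (p + t)) '' (Finset.filter _ _ : Finset (ℤ × ℤ))) ?_).trans
    ((Set.encard_image_le _ _).trans ((Set.encard_coe_eq_coe_finsetCard _).trans_le
      (Nat.cast_le.2 this)))
  intro q hq
  obtain ⟨v, rfl⟩ : ∃ v, q = p + v + t := ⟨q - p - t, by abel⟩
  have hv : v ∈ ({(1, 0), (0, 1), (1, 1), (-1, 0), (0, -1), (-1, -1)} : Finset (ℤ × ℤ)) := by
    have := sub_mem_of_adj hq
    simp only [Set.mem_insert_iff, Set.mem_singleton_iff, Prod.ext_iff, Prod.fst_sub,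
      Prod.snd_sub, Prod.fst_add, Prod.snd_add] at this
    simp only [Finset.mem_insert, Finset.mem_singleton, Prod.ext_iff]
    omega
  refine ⟨v, ?_, by simp only; abel⟩
  rw [Finset.mem_coe, Finset.mem_filter]
  refine ⟨hv, (adj_translate_iff s i j ?_ ?_ ?_ ?_).1 hq⟩ <;>
  · simp only [Finset.mem_insert, Finset.mem_singleton, Prod.ext_iff] at hv
    simp only [hp, Prod.snd_add]
    omega

theorem le_dil_blockGraph (s : ℤ → Bool) : ENNReal.ofReal (1 + √2) ≤ dil (blockGraph s) := by
  refine le_iSup_of_le (1, 0) (le_iSup_of_le (1, 1) (le_iSup_of_le (by decide) ?_))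
  have h₁ : Dist.dist (toC (1, 0)) (toC (1, 1)) = 1 := by simp [dist_toC]
  rw [h₁, ENNReal.ofReal_one, div_one]
  refine le_iInf fun w => ENNReal.ofReal_le_ofReal ?_
  have s2 : √2 ≤ 2 := Real.sqrt_le_sqrt (by norm_num) |>.trans (Real.sqrt_sq (by norm_num)).le
  cases w with
  | @cons _ v _ h w =>
    have hw := dist_le_walkLen w
    rw [walkLen]
    have hn : ¬ (blockGraph s).Adj (1, 0) (1, 1) := by
      simp [blockGraph, outEdge]
    have hv := sub_mem_of_adj h
    obtain ⟨x, y⟩ := v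
    have s1 : 1 ≤ √2 := Real.one_le_sqrt.2 (by norm_num)
    have s5 : √2 ≤ √5 := Real.sqrt_le_sqrt (by norm_num)
    have hxy : (x = 2 ∧ y = 0) ∨ (x = 1 ∧ y = 1) ∨ (x = 2 ∧ y = 1) ∨ (x = 0 ∧ y = 0) ∨
        (x = 1 ∧ y = -1) ∨ (x = 0 ∧ y = -1) := by
      simp only [Set.mem_insert_iff, Set.mem_singleton_iff, Prod.ext_iff, Prod.fst_sub,
        Prod.snd_sub] at hv
      omega
    rw [dist_toC] at hw ⊢
    rcases hxy with ⟨rfl, rfl⟩ | ⟨rfl, rfl⟩ | ⟨rfl, rfl⟩ | ⟨rfl, rfl⟩ | ⟨rfl, rfl⟩ | ⟨rfl, rfl⟩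
    case inr.inl => exact absurd h hn
    all_goals norm_num at hw ⊢; linarith

theorem blockGraph_injective : Function.Injective blockGraph := by
  have key (s : ℤ → Bool) (j : ℤ) :
      (blockGraph s).Adj ((1, 1) + (4 * 0 + 2 * j, 3 * j)) ((2, 1) + (4 * 0 + 2 * j, 3 * j)) ↔
        s j = false := by
    rw [adj_translate_iff s 0 j (by norm_num) (by norm_num) (by norm_num) (by norm_num)]
    generalize s (j - 1) = b₀, s j = b₁, s (j + 1) = b₂
    revert b₀ b₁ b₂
    decide
  intro s s' h
  ext j
  rw [← Bool.not_inj_iff, Bool.eq_iff_iff]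
  simp only [Bool.not_eq_true', ← key, h]

/-- There are uncountably many plane geometric graphs on ℤ² of maximum degree at most 3
whose dilation equals 1+√2. -/
theorem uncountably_many_optimal :
    ¬ ({G : SimpleGraph (ℤ × ℤ) |
        IsPlane G ∧ MaxDegThree G ∧ dil G = ENNReal.ofReal (1 + Real.sqrt 2)}.Countable) := by
  intro h
  have : Countable (ℤ → Bool) := by
    rw [← Set.countable_univ_iff]
    refine (h.preimage_of_injOn blockGraph_injective.injOn).mono fun s _ => ?_
    exact ⟨isPlane_of_adj fun _ _ => sub_mem_of_adj, maxDegThree_blockGraph s,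
      (dil_blockGraph_le s).antisymm (le_dil_blockGraph s)⟩
  obtain ⟨f, hf⟩ := exists_surjective_nat (ℤ → Bool)
  obtain ⟨n, hn⟩ := hf fun k => !f k.toNat k
  simpa using congrFun hn n
end

section
/- Let H be the undirected weighted graph with vertex set ℤ² in which, for a, b ∈ ℤ²: if |a−b| ∈ {1, √2} there is an edge between a and b of weight (1+√2)·|a−b|; if |a−b| = √5 there is an edge between a and b of weight 3+√2; and there are no other edges. Then for all p, q ∈ ℤ², the weighted graph distance satisfies d_H(p,q) ≤ (1+√2)·|p−q|. -/
open SimpleGraph ENNReal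

/-- Adjacency relation of the weighted graph `H`: lattice points at Euclidean distance
`1`, `√2` or `√5` are joined by an edge. -/
def HAdj (a b : ℤ × ℤ) : Prop :=
  dist (toC a) (toC b) = 1 ∨ dist (toC a) (toC b) = Real.sqrt 2 ∨
    dist (toC a) (toC b) = Real.sqrt 5

/-- The (unweighted skeleton of the) graph `H` on `ℤ²`. -/
def latticeH : SimpleGraph (ℤ × ℤ) := SimpleGraph.fromRel HAdj

open Classical in
/-- The weight of an edge of `H`: `(1+√2)·|a−b|` for edges of length `1` or `√2`,
and `3+√2` for edges of length `√5`. -/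
noncomputable def wt (a b : ℤ × ℤ) : ℝ :=
  if dist (toC a) (toC b) = Real.sqrt 5 then 3 + Real.sqrt 2
  else (1 + Real.sqrt 2) * dist (toC a) (toC b)

/-- The total weight of a walk in `H`. -/
noncomputable def wWalkLen : ∀ {p q : ℤ × ℤ}, latticeH.Walk p q → ℝ
  | _, _, .nil => 0
  | p, _, .cons (v := v) _ w => wt p v + wWalkLen w

/-- The weighted graph distance in `H`. -/
noncomputable def wdist (p q : ℤ × ℤ) : ℝ≥0∞ :=
  ⨅ w : latticeH.Walk p q, ENNReal.ofReal (wWalkLen w)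

theorem dist_toC_add {a d : ℤ × ℤ} {n : ℕ} (h : d.1 ^ 2 + d.2 ^ 2 = n) :
    dist (toC a) (toC (a + d)) = Real.sqrt n := by
  have h' : (d.1 : ℝ) ^ 2 + (d.2 : ℝ) ^ 2 = n := by exact_mod_cast h
  rw [Complex.dist_eq_re_im, ← h']
  congr 1
  simp only [toC, Prod.fst_add, Prod.snd_add, Int.cast_add]
  ring

/-- There is a walk in `H` from `p` to `q` of total weight at most `c`. -/
def ReachableWithin (p q : ℤ × ℤ) (c : ℝ) : Prop :=
  ∃ w : latticeH.Walk p q, wWalkLen w ≤ c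

theorem wWalkLen_append {p q r : ℤ × ℤ} (w : latticeH.Walk p q) (w' : latticeH.Walk q r) :
    wWalkLen (w.append w') = wWalkLen w + wWalkLen w' := by
  induction w with
  | nil => simp [wWalkLen]
  | cons h w ih => simp [wWalkLen, ih, add_assoc]

theorem ReachableWithin.trans {p q r : ℤ × ℤ} {c c' : ℝ} (h : ReachableWithin p q c)
    (h' : ReachableWithin q r c') : ReachableWithin p r (c + c') := by
  obtain ⟨w, hw⟩ := h
  obtain ⟨w', hw'⟩ := h'
  exact ⟨w.append w', by rw [wWalkLen_append]; exact add_le_add hw hw'⟩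

theorem ReachableWithin.wdist_le {p q : ℤ × ℤ} {c : ℝ} (h : ReachableWithin p q c) :
    wdist p q ≤ ENNReal.ofReal c := by
  obtain ⟨w, hw⟩ := h
  exact (iInf_le _ w).trans (ENNReal.ofReal_le_ofReal hw)

theorem reachableWithin_of_hAdj {a b : ℤ × ℤ} (hab : a ≠ b) (h : HAdj a b) :
    ReachableWithin a b (wt a b) :=
  ⟨.cons ((SimpleGraph.fromRel_adj _ _ _).2 ⟨hab, .inl h⟩) .nil, by simp [wWalkLen]⟩

theorem ne_add_of_sq_add_sq {a d : ℤ × ℤ} {n : ℤ} (hn : n ≠ 0) (h : d.1 ^ 2 + d.2 ^ 2 = n) :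
    a ≠ a + d := by
  intro hd
  rw [left_eq_add] at hd
  subst hd
  simp at h
  exact hn h.symm

theorem reachableWithin_add_of_sq_eq_one (a : ℤ × ℤ) {d : ℤ × ℤ} (h : d.1 ^ 2 + d.2 ^ 2 = 1) :
    ReachableWithin a (a + d) (1 + Real.sqrt 2) := by
  have hd : dist (toC a) (toC (a + d)) = 1 := by
    simpa using dist_toC_add (a := a) (d := d) (n := 1) (by simpa using h)
  have hw : wt a (a + d) = 1 + Real.sqrt 2 := by
    rw [wt, hd, if_neg, mul_one]
    rw [eq_comm, Real.sqrt_eq_one]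
    norm_num
  exact hw ▸ reachableWithin_of_hAdj (ne_add_of_sq_add_sq one_ne_zero h) (.inl hd)

theorem reachableWithin_add_of_sq_eq_two (a : ℤ × ℤ) {d : ℤ × ℤ} (h : d.1 ^ 2 + d.2 ^ 2 = 2) :
    ReachableWithin a (a + d) (2 + Real.sqrt 2) := by
  have hd : dist (toC a) (toC (a + d)) = Real.sqrt 2 := by
    simpa using dist_toC_add (a := a) (d := d) (n := 2) (by simpa using h)
  have hw : wt a (a + d) = 2 + Real.sqrt 2 := by
    rw [wt, hd, if_neg]
    · nlinarith [Real.sq_sqrt (show (0 : ℝ) ≤ 2 by norm_num)]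
    · rw [Real.sqrt_inj (by norm_num) (by norm_num)]
      norm_num
  exact hw ▸ reachableWithin_of_hAdj (ne_add_of_sq_add_sq two_ne_zero h) (.inr (.inl hd))

theorem reachableWithin_add_of_sq_eq_five (a : ℤ × ℤ) {d : ℤ × ℤ} (h : d.1 ^ 2 + d.2 ^ 2 = 5) :
    ReachableWithin a (a + d) (3 + Real.sqrt 2) := by
  have hd : dist (toC a) (toC (a + d)) = Real.sqrt 5 := by
    simpa using dist_toC_add (a := a) (d := d) (n := 5) (by simpa using h)
  have hw : wt a (a + d) = 3 + Real.sqrt 2 := by rw [wt, if_pos hd]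
  exact hw ▸ reachableWithin_of_hAdj (ne_add_of_sq_add_sq (by norm_num) h) (.inr (.inr hd))

theorem reachableWithin_add_nsmul {d : ℤ × ℤ} {c : ℝ} (h : ∀ a, ReachableWithin a (a + d) c)
    (n : ℕ) (a : ℤ × ℤ) : ReachableWithin a (a + n • d) (n * c) := by
  induction n with
  | zero =>
    rw [zero_smul, add_zero]
    exact ⟨.nil, by simp [wWalkLen]⟩
  | succ n ih =>
    have := ih.trans (h (a + n • d))
    rwa [add_assoc, ← succ_nsmul, show n * c + c = ((n + 1 : ℕ) : ℝ) * c by push_cast; ring]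
      at this

/-- The distance bound for a displacement `x • e + y • f` with `e`, `f` orthonormal and `y ≤ x`. -/
theorem wdist_add_le_of_orthonormal (p : ℤ × ℤ) {e f : ℤ × ℤ} (he : e.1 ^ 2 + e.2 ^ 2 = 1)
    (hf : f.1 ^ 2 + f.2 ^ 2 = 1) (hef : e.1 * f.1 + e.2 * f.2 = 0) {x y : ℕ} (hyx : y ≤ x) :
    wdist p (p + (x • e + y • f)) ≤
      ENNReal.ofReal ((1 + Real.sqrt 2) * dist (toC p) (toC (p + (x • e + y • f)))) := by
  have hdist := dist_toC_add (a := p) (d := x • e + y • f) (n := x ^ 2 + y ^ 2) (by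
    simp only [Prod.fst_add, Prod.snd_add, Prod.smul_fst, Prod.smul_snd]
    simp only [nsmul_eq_mul]
    push_cast
    linear_combination (x : ℤ) ^ 2 * he + (y : ℤ) ^ 2 * hf + 2 * (x : ℤ) * y * hef)
  have hknight (a : ℤ × ℤ) : ReachableWithin a (a + (2 • e + f)) (3 + Real.sqrt 2) := by
    refine reachableWithin_add_of_sq_eq_five a ?_
    simp only [Prod.fst_add, Prod.snd_add, Prod.smul_fst, Prod.smul_snd]
    simp only [nsmul_eq_mul]
    push_cast
    linear_combination 4 * he + hf + 4 * hef
  have hdiag (a : ℤ × ℤ) : ReachableWithin a (a + (e + f)) (2 + Real.sqrt 2) := by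
    refine reachableWithin_add_of_sq_eq_two a ?_
    simp only [Prod.fst_add, Prod.snd_add]
    linear_combination he + hf + 2 * hef
  have hs : Real.sqrt 2 ^ 2 = 2 := Real.sq_sqrt (by norm_num)
  have hs1 : 1 ≤ Real.sqrt 2 := Real.one_le_sqrt.2 (by norm_num)
  have hy0 : (0 : ℝ) ≤ y := y.cast_nonneg
  rw [hdist]
  push_cast
  set r := Real.sqrt ((x : ℝ) ^ 2 + (y : ℝ) ^ 2) with hr
  rcases le_total (2 * y) x with h | h
  · obtain ⟨k, rfl⟩ := Nat.exists_eq_add_of_le h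
    have hwalk := (reachableWithin_add_nsmul hknight y p).trans
      (reachableWithin_add_nsmul (fun a => reachableWithin_add_of_sq_eq_one a he) k _)
    rw [show p + y • (2 • e + f) + k • e = p + ((2 * y + k) • e + y • f) by module] at hwalk
    refine hwalk.wdist_le.trans (ENNReal.ofReal_le_ofReal ?_)
    have hxr : ((2 * y + k : ℕ) : ℝ) ≤ r := Real.le_sqrt_of_sq_le (by nlinarith)
    push_cast at hxr
    nlinarith
  · obtain ⟨k, rfl⟩ := Nat.exists_eq_add_of_le hyx
    obtain ⟨m, rfl⟩ := Nat.exists_eq_add_of_le (show k ≤ y by lia)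
    have hwalk := (reachableWithin_add_nsmul hknight k p).trans
      (reachableWithin_add_nsmul hdiag m _)
    rw [show p + k • (2 • e + f) + m • (e + f) = p + ((k + m + k) • e + (k + m) • f) by module]
      at hwalk
    refine hwalk.wdist_le.trans (ENNReal.ofReal_le_ofReal ?_)
    have hk : (0 : ℝ) ≤ k := k.cast_nonneg
    have hm : (0 : ℝ) ≤ m := m.cast_nonneg
    have hr2 : r ^ 2 = (2 * k + m : ℝ) ^ 2 + (k + m : ℝ) ^ 2 := by
      rw [hr, Real.sq_sqrt (by positivity)]
      push_cast
      ring
    have hr0 : 0 ≤ r := Real.sqrt_nonneg _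
    refine abs_le_of_sq_le_sq' ?_ (by positivity) |>.2
    have hgap : ((1 + Real.sqrt 2) * r) ^ 2 - (k * (3 + Real.sqrt 2) + m * (2 + Real.sqrt 2)) ^ 2 =
        2 * (1 + Real.sqrt 2) * (2 * k + m) * k := by
      rw [mul_pow, hr2]
      linear_combination ((2 * k + m : ℝ) ^ 2) * hs
    have : 0 ≤ 2 * (1 + Real.sqrt 2) * (2 * k + m) * k := by positivity
    linarith

theorem Int.exists_sq_eq_one_mul_natAbs (a : ℤ) : ∃ s : ℤ, s ^ 2 = 1 ∧ a = a.natAbs * s := by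
  rcases le_total 0 a with h | h
  · exact ⟨1, by norm_num, by lia⟩
  · exact ⟨-1, by norm_num, by lia⟩

/-- For all p, q ∈ ℤ², the weighted distance in `H` is at most `(1+√2)·|p−q|`. -/
theorem weighted_graph_distance_bound (p q : ℤ × ℤ) :
    wdist p q ≤ ENNReal.ofReal ((1 + Real.sqrt 2) * dist (toC p) (toC q)) := by
  obtain ⟨s, hs, hx⟩ := Int.exists_sq_eq_one_mul_natAbs (q.1 - p.1)
  obtain ⟨t, ht, hy⟩ := Int.exists_sq_eq_one_mul_natAbs (q.2 - p.2)
  set x := (q.1 - p.1).natAbs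
  set y := (q.2 - p.2).natAbs
  have hq : q = p + (x • (s, 0) + y • (0, t)) := by
    ext <;> simp [← hx, ← hy]
  rcases le_total y x with h | h
  · rw [hq]
    exact wdist_add_le_of_orthonormal p (by simpa using hs) (by simpa using ht) (by simp) h
  · rw [hq, add_comm (x • _)]
    exact wdist_add_le_of_orthonormal p (by simpa using ht) (by simpa using hs) (by simp) h
end
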